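/- Let 0 < α < 1 and a ∈ ℝ, and define u : [0,∞) → ℝ by u(t) = E_α(a t^α). Then u solves the scalar fractional relaxation equation: for every t > 0, the Caputo fractional derivative ^C D^α u (t) = a · E_α(a t^α) = a·u(t), and u(0) = 1. -/

import Mathlib

/-- The two-parameter Mittag-Leffler function `E_{α,β}(z) = ∑_{k=0}^∞ z^k/Γ(αk + β)`. -/
noncomputable def mittagLeffler (α β z : ℝ) : ℝ :=
  ∑' k : ℕ, z ^ k / Real.Gamma (α * k + β)

/-- The Caputo fractional derivative of order `α ∈ (0,1)` of a differentiable function `f`: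
`^C D^α f(t) = (1/Γ(1−α)) ∫₀^t f′(s)·(t−s)^{−α} ds`. -/
noncomputable def caputo (α : ℝ) (f : ℝ → ℝ) (t : ℝ) : ℝ :=
  (1 / Real.Gamma (1 - α)) * ∫ s in (0 : ℝ)..t, deriv f s * (t - s) ^ (-α)

open MeasureTheory Set

/-- Restricting Euler's integral to `(M, ∞)` bounds the Gamma function from below. -/
lemma rpow_mul_exp_neg_le_Gamma_add_one {M x : ℝ} (hM : 0 < M) (hx : 0 ≤ x) :
    M ^ x * Real.exp (-M) ≤ Real.Gamma (x + 1) := by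
  have hint := Real.GammaIntegral_convergent (s := x + 1) (by linarith)
  rw [Real.Gamma_eq_integral (by linarith), ← integral_exp_neg_Ioi, ← integral_const_mul]
  have hsub : Ioi M ⊆ Ioi 0 := Ioi_subset_Ioi hM.le
  calc ∫ y in Ioi M, M ^ x * Real.exp (-y)
      ≤ ∫ y in Ioi M, Real.exp (-y) * y ^ (x + 1 - 1) := by
        refine setIntegral_mono_on ((integrableOn_exp_neg_Ioi M).const_mul _)
          (hint.mono_set hsub) measurableSet_Ioi fun y hy => ?_
        rw [mul_comm, add_sub_cancel_right]
        have : M ≤ y := le_of_lt hy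
        gcongr
    _ ≤ ∫ y in Ioi 0, Real.exp (-y) * y ^ (x + 1 - 1) := by
        refine setIntegral_mono_set hint ?_ hsub.eventuallyLE
        refine (ae_restrict_mem measurableSet_Ioi).mono fun y hy => ?_
        have : 0 < y := hy
        simp only [Pi.zero_apply]
        positivity

lemma one_div_Gamma_le {M x : ℝ} (hM : 0 < M) (hx : 0 < x) :
    1 / Real.Gamma x ≤ x * Real.exp M / M ^ x := by
  have h := rpow_mul_exp_neg_le_Gamma_add_one hM hx.le
  have hG := Real.Gamma_pos_of_pos hx
  have hMx : 0 < M ^ x := Real.rpow_pos_of_pos hM x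
  rw [Real.Gamma_add_one hx.ne', Real.exp_neg, ← div_eq_mul_inv,
    div_le_iff₀ (Real.exp_pos M)] at h
  rw [div_le_div_iff₀ hG hMx]
  linarith

/-- The Mittag-Leffler series converges everywhere. -/
lemma summable_mittagLeffler {α β : ℝ} (hα : 0 < α) (hβ : 0 < β) (z : ℝ) :
    Summable fun k : ℕ => z ^ k / Real.Gamma (α * k + β) := by
  set R : ℝ := 2 * |z| + 1
  have hz := abs_nonneg z
  have hR : 0 < R := by positivity
  set M : ℝ := R ^ α⁻¹
  have hM : 0 < M := Real.rpow_pos_of_pos hR _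
  have hMα : M ^ α = R := Real.rpow_inv_rpow hR.le hα.ne'
  have hq : ‖|z| / R‖ < 1 := by
    rw [Real.norm_of_nonneg (by positivity), div_lt_one hR]
    simp only [R]; linarith
  have hsum : Summable fun k : ℕ =>
      Real.exp M / M ^ β * (α * ((k : ℝ) ^ 1 * (|z| / R) ^ k) + β * (|z| / R) ^ k) :=
    (((summable_pow_mul_geometric_of_norm_lt_one 1 hq).mul_left α).add
      ((summable_geometric_of_norm_lt_one hq).mul_left β)).mul_left _
  refine Summable.of_norm_bounded hsum fun k => ?_
  have hx : 0 < α * k + β := by positivity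
  have hMk : M ^ (α * k + β) = R ^ k * M ^ β := by
    rw [Real.rpow_add hM, Real.rpow_mul hM.le, hMα, Real.rpow_natCast]
  have hMβ : 0 < M ^ β := Real.rpow_pos_of_pos hM β
  rw [norm_div, norm_pow, Real.norm_eq_abs, Real.norm_of_nonneg (Real.Gamma_pos_of_pos hx).le]
  calc |z| ^ k / Real.Gamma (α * k + β) = |z| ^ k * (1 / Real.Gamma (α * k + β)) := by ring
    _ ≤ |z| ^ k * ((α * k + β) * Real.exp M / M ^ (α * k + β)) := by
        exact mul_le_mul_of_nonneg_left (one_div_Gamma_le hM hx) (by positivity)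
    _ = _ := by
        rw [hMk, div_pow]
        field_simp

/-- Euler's beta integral over `[0, t]`. -/
lemma integral_rpow_mul_sub_rpow {p q t : ℝ} (hp : 0 < p) (hq : 0 < q) (ht : 0 < t) :
    ∫ s in (0 : ℝ)..t, s ^ (p - 1) * (t - s) ^ (q - 1) =
      t ^ (p + q - 1) * (Real.Gamma p * Real.Gamma q / Real.Gamma (p + q)) := by
  have h := Complex.betaIntegral_scaled p q ht
  rw [Complex.betaIntegral_eq_Gamma_mul_div _ _ (by simpa) (by simpa)] at h
  apply Complex.ofReal_injective
  rw [← intervalIntegral.integral_ofReal]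
  convert h using 1
  · refine intervalIntegral.integral_congr fun s hs => ?_
    rw [uIcc_of_le ht.le] at hs
    rw [Complex.ofReal_mul, Complex.ofReal_cpow hs.1, Complex.ofReal_cpow (sub_nonneg.2 hs.2)]
    push_cast
    rfl
  · rw [Complex.ofReal_mul, Complex.ofReal_cpow ht.le]
    push_cast
    rw [← Complex.ofReal_add p q]
    simp only [Complex.Gamma_ofReal]

lemma intervalIntegrable_rpow_mul_sub_rpow {p q t : ℝ} (hp : 0 < p) (hq : 0 < q) (ht : 0 < t) :
    IntervalIntegrable (fun s : ℝ => s ^ (p - 1) * (t - s) ^ (q - 1)) volume 0 t := by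
  by_contra h
  have h0 := integral_rpow_mul_sub_rpow hp hq ht
  rw [intervalIntegral.integral_undef h] at h0
  have := Real.Gamma_pos_of_pos hp
  have := Real.Gamma_pos_of_pos hq
  have := Real.Gamma_pos_of_pos (add_pos hp hq)
  have := Real.rpow_pos_of_pos ht (p + q - 1)
  exact absurd h0 (by positivity)

lemma mul_rpow_pow {α a s : ℝ} (hs : 0 ≤ s) (k : ℕ) :
    (a * s ^ α) ^ k = a ^ k * s ^ (α * k) := by
  rw [mul_pow, Real.rpow_mul hs, Real.rpow_natCast]

lemma mittagLeffler_one_eq_one_add {α : ℝ} (hα : 0 < α) (z : ℝ) :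
    mittagLeffler α 1 z = 1 + ∑' k : ℕ, z ^ (k + 1) / Real.Gamma (α * (k + 1) + 1) := by
  rw [mittagLeffler, (summable_mittagLeffler hα one_pos z).tsum_eq_zero_add]
  simp

/-- Termwise differentiation of `τ ↦ E_α(a τ^α)` on the positive half-line. -/
lemma hasDerivAt_mittagLeffler_rpow {α : ℝ} (hα : 0 < α) (a : ℝ) {s : ℝ} (hs : 0 < s) :
    HasDerivAt (fun τ : ℝ => mittagLeffler α 1 (a * τ ^ α))
      (∑' k : ℕ, a ^ (k + 1) * s ^ (α * (k + 1) - 1) / Real.Gamma (α * (k + 1))) s := by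
  simp_rw [mittagLeffler_one_eq_one_add hα]
  apply HasDerivAt.const_add
  have hmem : s ∈ Ioo (s / 2) (2 * s) := ⟨by linarith, by linarith⟩
  have hpos : ∀ {y : ℝ}, y ∈ Ioo (s / 2) (2 * s) → 0 < y := fun hy => by linarith [hy.1]
  set r : ℝ := |a| * (2 * s) ^ α
  have hbound : Summable fun k : ℕ => r / (s / 2) * (r ^ k / Real.Gamma (α * k + α)) :=
    (summable_mittagLeffler hα hα r).mul_left _
  refine hasDerivAt_tsum_of_isPreconnected
    (g := fun (k : ℕ) (τ : ℝ) => (a * τ ^ α) ^ (k + 1) / Real.Gamma (α * (k + 1) + 1))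
    (g' := fun (k : ℕ) (τ : ℝ) =>
      a ^ (k + 1) * τ ^ (α * (k + 1) - 1) / Real.Gamma (α * (k + 1))) (t := Ioo (s / 2) (2 * s)) hbound isOpen_Ioo
    isPreconnected_Ioo (fun k y hy => ?_) (fun k y hy => ?_) hmem ?_ hmem
  · have hy0 := hpos hy
    have hx : 0 < α * ((k : ℝ) + 1) := by positivity
    have hG := (Real.Gamma_pos_of_pos hx).ne'
    have hd := ((Real.hasDerivAt_rpow_const (p := α * ((k : ℝ) + 1)) (Or.inl hy0.ne')).const_mul
      (a ^ (k + 1))).div_const (Real.Gamma (α * (k + 1) + 1))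
    have hval : a ^ (k + 1) * (α * ((k : ℝ) + 1) * y ^ (α * ((k : ℝ) + 1) - 1)) /
        Real.Gamma (α * (k + 1) + 1) =
        a ^ (k + 1) * y ^ (α * ((k : ℝ) + 1) - 1) / Real.Gamma (α * (k + 1)) := by
      rw [Real.Gamma_add_one hx.ne']
      field_simp
    rw [hval] at hd
    refine hd.congr_of_eventuallyEq ?_
    filter_upwards [lt_mem_nhds hy0] with τ hτ
    rw [mul_rpow_pow (le_of_lt hτ)]
    push_cast
    rfl
  · have hy0 := hpos hy
    have hx : 0 < α * ((k : ℝ) + 1) := by positivity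
    have hG := Real.Gamma_pos_of_pos hx
    have hαk : α * (k : ℝ) + α = α * (k + 1) := by ring
    rw [hαk, norm_div, norm_mul, norm_pow, Real.norm_eq_abs, Real.norm_of_nonneg hG.le,
      Real.norm_of_nonneg (Real.rpow_nonneg hy0.le _), Real.rpow_sub_one hy0.ne']
    have hle : |a| ^ (k + 1) * y ^ (α * ((k : ℝ) + 1)) ≤ r ^ (k + 1) := by
      have h2 : r ^ (k + 1) = |a| ^ (k + 1) * (2 * s) ^ (α * ((k : ℝ) + 1)) := by
        simp only [r]
        rw [mul_rpow_pow (by positivity)]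
        push_cast
        rfl
      rw [h2]
      have := hy.2.le
      gcongr
    calc |a| ^ (k + 1) * (y ^ (α * ((k : ℝ) + 1)) / y) / Real.Gamma (α * (k + 1))
        = |a| ^ (k + 1) * y ^ (α * ((k : ℝ) + 1)) / y / Real.Gamma (α * (k + 1)) := by ring
      _ ≤ r ^ (k + 1) / (s / 2) / Real.Gamma (α * (k + 1)) := by
          have := hy.1.le
          have : 0 ≤ r := by positivity
          gcongr
      _ = _ := by ring
  · have := (summable_nat_add_iff 1).2 (summable_mittagLeffler hα one_pos (a * s ^ α))
    push_cast at this
    exact this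

/-- The Caputo kernel integrates the derivative series of `E_α(a τ^α)` termwise. -/
lemma hasSum_integral_deriv_mittagLeffler_rpow {α : ℝ} (hα0 : 0 < α) (hα1 : α < 1) (a : ℝ)
    {t : ℝ} (ht : 0 < t) :
    HasSum (fun k : ℕ => Real.Gamma (1 - α) * a * ((a * t ^ α) ^ k / Real.Gamma (α * k + 1)))
      (∫ s in (0 : ℝ)..t,
        deriv (fun τ : ℝ => mittagLeffler α 1 (a * τ ^ α)) s * (t - s) ^ (-α)) := by
  have hq : 0 < 1 - α := by linarith
  have hx : ∀ k : ℕ, 0 < α * ((k : ℝ) + 1) := fun k => by positivity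
  have hexp : 1 - α - 1 = -α := by ring
  let G : ℕ → ℝ → ℝ := fun k s => s ^ (α * ((k : ℝ) + 1) - 1) * (t - s) ^ (-α)
  have hGint : ∀ k, IntegrableOn (G k) (Ioc 0 t) := fun k => by
    have := intervalIntegrable_rpow_mul_sub_rpow (hx k) hq ht
    rw [hexp] at this
    exact (intervalIntegrable_iff_integrableOn_Ioc_of_le ht.le).1 this
  have hGval : ∀ (b : ℝ) (k : ℕ), b ^ (k + 1) / Real.Gamma (α * (k + 1)) * ∫ s in Ioc 0 t, G k s =
      Real.Gamma (1 - α) * b * ((b * t ^ α) ^ k / Real.Gamma (α * k + 1)) := fun b k => by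
    have h := integral_rpow_mul_sub_rpow (hx k) hq ht
    have e1 : α * ((k : ℝ) + 1) + (1 - α) = α * k + 1 := by ring
    rw [hexp, e1, add_sub_cancel_right, intervalIntegral.integral_of_le ht.le] at h
    have hne := (Real.Gamma_pos_of_pos (hx k)).ne'
    rw [show ∫ s in Ioc 0 t, G k s = _ from h, mul_rpow_pow ht.le]
    field_simp
    ring
  let F : ℕ → ℝ → ℝ := fun k s => a ^ (k + 1) / Real.Gamma (α * (k + 1)) * G k s
  have hFint : ∀ k, Integrable (F k) (volume.restrict (Ioc 0 t)) := fun k =>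
    (hGint k).const_mul _
  have hFnorm : ∀ k, ∫ s in Ioc 0 t, ‖F k s‖ =
      Real.Gamma (1 - α) * |a| * ((|a| * t ^ α) ^ k / Real.Gamma (α * k + 1)) := fun k => by
    rw [← hGval, ← integral_const_mul]
    refine setIntegral_congr_fun measurableSet_Ioc fun s hs => ?_
    have hG0 : 0 ≤ G k s := mul_nonneg (Real.rpow_nonneg hs.1.le _)
      (Real.rpow_nonneg (sub_nonneg.2 hs.2) _)
    simp only [F]
    rw [norm_mul, norm_div, norm_pow, Real.norm_eq_abs,
      Real.norm_of_nonneg (Real.Gamma_pos_of_pos (hx k)).le, Real.norm_of_nonneg hG0]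
  have hsum : Summable fun k => ∫ s in Ioc 0 t, ‖F k s‖ := by
    simp_rw [hFnorm]
    exact (summable_mittagLeffler hα0 one_pos _).mul_left _
  have key := hasSum_integral_of_summable_integral_norm hFint hsum
  have hlim : ∫ s in (0 : ℝ)..t,
      deriv (fun τ : ℝ => mittagLeffler α 1 (a * τ ^ α)) s * (t - s) ^ (-α) =
      ∫ s in Ioc 0 t, ∑' k, F k s := by
    rw [intervalIntegral.integral_of_le ht.le]
    refine setIntegral_congr_fun measurableSet_Ioc fun s hs => ?_
    rw [(hasDerivAt_mittagLeffler_rpow hα0 a hs.1).deriv, ← tsum_mul_right]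
    refine tsum_congr fun k => ?_
    simp only [F, G]
    ring
  rw [hlim]
  refine key.congr_fun fun k => ?_
  rw [← hGval, ← integral_const_mul]

/-- For `0 < α < 1` and `a ∈ ℝ`, the function `u(t) = E_α(a t^α)` solves the scalar
fractional relaxation equation: `^C D^α u(t) = a·E_α(a t^α) = a·u(t)` for all `t > 0`,
and `u(0) = 1`. -/
theorem mittagLeffler_solves_fractional_relaxation (α a : ℝ) (hα0 : 0 < α) (hα1 : α < 1) :
    (∀ t : ℝ, 0 < t →
      caputo α (fun τ : ℝ => mittagLeffler α 1 (a * τ ^ α)) t =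
        a * mittagLeffler α 1 (a * t ^ α)) ∧
    mittagLeffler α 1 (a * (0 : ℝ) ^ α) = 1 := by
  refine ⟨fun t ht => ?_, ?_⟩
  · have hG := (Real.Gamma_pos_of_pos (show 0 < 1 - α by linarith)).ne'
    rw [caputo, ← (hasSum_integral_deriv_mittagLeffler_rpow hα0 hα1 a ht).tsum_eq, tsum_mul_left,
      mittagLeffler]
    field_simp
  · rw [Real.zero_rpow hα0.ne', mul_zero, mittagLeffler_one_eq_one_add hα0]
    simp
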